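/- In the configuration model with m edges, the probability that two distinct nodes i and j with degrees k_i and k_j are connected by at least one edge equals ∑_{t=1}^{min(k_i,k_j)} (-1)^{t+1} · C(k_i,t)·C(k_j,t)·t! / ∏_{p=1}^{t}(2m+1-2p). -/

import Mathlib

/-- Perfect matchings of `α`, viewed as fixed-point-free involutions. -/
abbrev PerfectMatching (α : Type*) : Type _ :=
  {f : α ≃ α // (∀ x, f (f x) = x) ∧ ∀ x, f x ≠ x}

namespace PerfectMatching

variable {α : Type*}

theorem nonempty_of_card [Fintype α] {m : ℕ} (hcard : Fintype.card α = 2 * m) :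
    Nonempty (PerfectMatching α) := by
  let e : α ≃ Fin m ⊕ Fin m := Fintype.equivOfCardEq (by simp [hcard, two_mul])
  refine ⟨⟨(e.trans (Equiv.sumComm _ _)).trans e.symm, fun x => by simp, fun x h => ?_⟩⟩
  have h' : (e x).swap = e x := by simpa [Equiv.symm_apply_eq] using h
  cases hx : e x <;> simp [hx] at h'

variable [DecidableEq α]

/-- Relabel the points `a` and `b` of a perfect matching. -/
def relabel (f : PerfectMatching α) (a b : α) : PerfectMatching α :=
  ⟨((Equiv.swap a b).trans f.1).trans (Equiv.swap a b), fun x => by simp [f.2.1],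
    fun x h => f.2.2 (Equiv.swap a b x) (by
      simpa using congrArg (Equiv.swap a b) h)⟩

theorem relabel_apply (f : PerfectMatching α) (a b x : α) :
    (f.relabel a b).1 x = Equiv.swap a b (f.1 (Equiv.swap a b x)) := rfl

theorem relabel_relabel (f : PerfectMatching α) (a b : α) :
    (f.relabel a b).relabel b a = f := by
  apply Subtype.ext
  ext x
  simp [relabel_apply, Equiv.swap_comm b a]

theorem relabel_apply_of_ne (f : PerfectMatching α) {a b x : α} (ha : x ≠ a) (hb : x ≠ b)
    (hfa : f.1 x ≠ a) (hfb : f.1 x ≠ b) : (f.relabel a b).1 x = f.1 x := by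
  rw [relabel_apply, Equiv.swap_apply_of_ne_of_ne ha hb, Equiv.swap_apply_of_ne_of_ne hfa hfb]

theorem relabel_apply_partner (f : PerfectMatching α) {x z : α} (hz : z ≠ x) :
    (f.relabel (f.1 x) z).1 x = z := by
  rw [relabel_apply, Equiv.swap_apply_of_ne_of_ne (f.2.2 x).symm hz.symm, Equiv.swap_apply_left]

variable [Fintype α]

/-- The perfect matchings that match every point of `T` to a point of `B`. -/
def matchingInto (T B : Finset α) : Finset (PerfectMatching α) :=
  {f | ∀ x ∈ T, f.1 x ∈ B}

/-- The points outside `T`, the partners of `T`, and `x`. -/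
def free (f : PerfectMatching α) (T : Finset α) (x : α) : Finset α :=
  (insert x (T ∪ T.image f.1))ᶜ

theorem mem_free {f : PerfectMatching α} {T : Finset α} {x z : α} :
    z ∈ f.free T x ↔ z ≠ x ∧ z ∉ T ∧ ∀ y ∈ T, f.1 y ≠ z := by
  simp [free]

theorem apply_mem_free (f : PerfectMatching α) {T B : Finset α} {x : α} (hxB : x ∉ B)
    (hxT : x ∉ T) (hf : f ∈ matchingInto T B) : f.1 x ∈ f.free T x := by
  simp only [matchingInto, Finset.mem_filter, Finset.mem_univ, true_and] at hf
  refine mem_free.2 ⟨f.2.2 x, fun h => hxB ?_, fun y hy h => hxT (f.1.injective h ▸ hy)⟩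
  simpa [f.2.1] using hf _ h

theorem relabel_apply_eq (f : PerfectMatching α) {T B : Finset α} {x z : α} (hxB : x ∉ B)
    (hxT : x ∉ T) (hf : f ∈ matchingInto T B) (hz : z ∈ f.free T x) {y : α} (hy : y ∈ T) :
    (f.relabel (f.1 x) z).1 y = f.1 y := by
  obtain ⟨-, h₂, h₃⟩ := mem_free.1 (f.apply_mem_free hxB hxT hf)
  obtain ⟨-, k₂, k₃⟩ := mem_free.1 hz
  exact f.relabel_apply_of_ne (fun h => h₂ (h ▸ hy)) (fun h => k₂ (h ▸ hy)) (h₃ y hy) (k₃ y hy)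

theorem card_free (f : PerfectMatching α) {T B : Finset α} {x : α} (hTB : Disjoint T B)
    (hxB : x ∉ B) (hxT : x ∉ T) (hf : f ∈ matchingInto T B) :
    ((f.free T x).card : ℚ) = Fintype.card α - 1 - 2 * T.card := by
  simp only [matchingInto, Finset.mem_filter, Finset.mem_univ, true_and] at hf
  have hd : Disjoint T (T.image f.1) := hTB.mono_right (Finset.image_subset_iff.2 hf)
  have hx : x ∉ T ∪ T.image f.1 := by
    rw [Finset.mem_union, not_or]
    exact ⟨hxT, fun h => hxB (Finset.image_subset_iff.2 hf h)⟩
  have h := Finset.card_add_card_compl (insert x (T ∪ T.image f.1))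
  rw [Finset.card_insert_of_notMem hx, Finset.card_union_of_disjoint hd,
    Finset.card_image_of_injective _ f.1.injective] at h
  rw [free, ← h]
  push_cast
  ring

theorem card_free_inter (f : PerfectMatching α) {T B : Finset α} {x : α} (hTB : Disjoint T B)
    (hxB : x ∉ B) (hf : f ∈ matchingInto T B) :
    ((f.free T x ∩ B).card : ℚ) = B.card - T.card := by
  simp only [matchingInto, Finset.mem_filter, Finset.mem_univ, true_and] at hf
  have hsub : T.image f.1 ⊆ B := Finset.image_subset_iff.2 hf
  have heq : f.free T x ∩ B = B \ T.image f.1 := by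
    ext z
    simp only [Finset.mem_inter, mem_free, Finset.mem_sdiff, Finset.mem_image, not_exists, not_and]
    exact ⟨fun h => ⟨h.2, h.1.2.2⟩, fun h => ⟨⟨fun hzx => hxB (hzx ▸ h.1),
      fun hzT => Finset.disjoint_left.1 hTB hzT h.1, h.2⟩, h.1⟩⟩
  rw [heq, Finset.cast_card_sdiff hsub, Finset.card_image_of_injective _ f.1.injective]

theorem card_matchingInto_insert {T B : Finset α} {x : α} (hTB : Disjoint T B)
    (hxB : x ∉ B) (hxT : x ∉ T) :
    ((matchingInto (insert x T) B).card : ℚ) * (Fintype.card α - 1 - 2 * T.card) =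
      (matchingInto T B).card * (B.card - T.card) := by
  have hsub : matchingInto (insert x T) B ⊆ matchingInto T B := fun f hf => by
    simp only [matchingInto, Finset.mem_filter, Finset.mem_univ, true_and] at hf ⊢
    exact fun y hy => hf y (Finset.mem_insert_of_mem hy)
  have hrel : ∀ f ∈ matchingInto T B, ∀ z ∈ f.free T x,
      f.relabel (f.1 x) z ∈ matchingInto T B ∧
        f.1 x ∈ (f.relabel (f.1 x) z).free T x ∧ (f.relabel (f.1 x) z).1 x = z := by
    intro f hf z hz
    have key := fun y hy => f.relabel_apply_eq hxB hxT hf hz (y := y) hy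
    refine ⟨?_, ?_, f.relabel_apply_partner (mem_free.1 hz).1⟩
    · simp only [matchingInto, Finset.mem_filter, Finset.mem_univ, true_and] at hf ⊢
      exact fun y hy => by rw [key y hy]; exact hf y hy
    · obtain ⟨h₁, h₂, h₃⟩ := mem_free.1 (f.apply_mem_free hxB hxT hf)
      exact mem_free.2 ⟨h₁, h₂, fun y hy => by rw [key y hy]; exact h₃ y hy⟩
  have hcount : ((matchingInto (insert x T) B).sigma fun f => f.free T x).card =
      ((matchingInto T B).sigma fun f => f.free T x ∩ B).card := by
    refine Finset.card_bij' (fun p _ => ⟨p.1.relabel (p.1.1 x) p.2, p.1.1 x⟩)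
      (fun p _ => ⟨p.1.relabel (p.1.1 x) p.2, p.1.1 x⟩) ?_ ?_ ?_ ?_
    · rintro ⟨f, z⟩ hp
      obtain ⟨hf, hz⟩ := Finset.mem_sigma.1 hp
      obtain ⟨h₁, h₂, -⟩ := hrel f (hsub hf) z hz
      simp only [matchingInto, Finset.mem_filter, Finset.mem_univ, true_and] at hf
      exact Finset.mem_sigma.2 ⟨h₁, Finset.mem_inter.2 ⟨h₂, hf x (Finset.mem_insert_self _ _)⟩⟩
    · rintro ⟨f, z⟩ hp
      obtain ⟨hf, hz⟩ := Finset.mem_sigma.1 hp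
      obtain ⟨hz, hzB⟩ := Finset.mem_inter.1 hz
      obtain ⟨h₁, h₂, h₃⟩ := hrel f hf z hz
      refine Finset.mem_sigma.2 ⟨?_, h₂⟩
      simp only [matchingInto, Finset.mem_filter, Finset.mem_univ, true_and] at h₁ ⊢
      exact Finset.forall_mem_insert _ _ _ |>.2 ⟨h₃.symm ▸ hzB, h₁⟩
    · rintro ⟨f, z⟩ hp
      obtain ⟨hf, hz⟩ := Finset.mem_sigma.1 hp
      simp only [(hrel f (hsub hf) z hz).2.2, relabel_relabel]
    · rintro ⟨f, z⟩ hp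
      obtain ⟨hf, hz⟩ := Finset.mem_sigma.1 hp
      simp only [(hrel f hf z (Finset.mem_inter.1 hz).1).2.2, relabel_relabel]
  rw [Finset.card_sigma, Finset.card_sigma] at hcount
  have hq := congrArg (Nat.cast : ℕ → ℚ) hcount
  push_cast at hq
  rwa [Finset.sum_congr rfl fun f hf => f.card_free hTB hxB hxT (hsub hf),
    Finset.sum_congr (s₁ := matchingInto T B) rfl fun f hf => f.card_free_inter hTB hxB hf,
    Finset.sum_const, Finset.sum_const, nsmul_eq_mul, nsmul_eq_mul] at hq

theorem card_matchingInto_mul_prod {T B : Finset α} (hTB : Disjoint T B) :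
    ((matchingInto T B).card : ℚ) *
        ∏ p ∈ Finset.range T.card, ((Fintype.card α : ℚ) - 1 - 2 * p) =
      B.card.descFactorial T.card * Fintype.card (PerfectMatching α) := by
  induction T using Finset.induction_on with
  | empty => simp [matchingInto]
  | insert x T hxT ih =>
    obtain ⟨hxB, hTB⟩ := Finset.disjoint_insert_left.1 hTB
    have hdesc : ((B.card.descFactorial (T.card + 1) : ℕ) : ℚ) =
        (B.card - T.card) * B.card.descFactorial T.card := by
      rw [Nat.descFactorial_succ]
      rcases le_or_gt T.card B.card with h | h
      · push_cast [h]
        ring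
      · simp [Nat.descFactorial_of_lt h]
    rw [Finset.card_insert_of_notMem hxT, Finset.prod_range_succ, hdesc]
    linear_combination (∏ p ∈ Finset.range T.card, ((Fintype.card α : ℚ) - 1 - 2 * p)) *
      card_matchingInto_insert hTB hxB hxT + (B.card - T.card : ℚ) * ih hTB

theorem sum_choose_card_filter (A B : Finset α) (t : ℕ) :
    ∑ f : PerfectMatching α, (A.filter fun x => f.1 x ∈ B).card.choose t =
      ∑ T ∈ A.powersetCard t, (matchingInto T B).card := by
  have h := Finset.sum_card_bipartiteAbove_eq_sum_card_bipartiteBelow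
    (s := (Finset.univ : Finset (PerfectMatching α))) (t := A.powersetCard t)
    (fun f T => ∀ x ∈ T, f.1 x ∈ B)
  convert h using 2 with f
  · rw [← Finset.card_powersetCard]
    congr 1
    ext T
    simp only [Finset.mem_powersetCard, Finset.bipartiteAbove, Finset.mem_filter,
      Finset.subset_iff]
    grind
  · rfl

end PerfectMatching

theorem sum_Icc_neg_one_pow_mul_choose {n N : ℕ} (h : n ≤ N) :
    ∑ t ∈ Finset.Icc 1 N, (-1 : ℚ) ^ (t + 1) * n.choose t = if n = 0 then 0 else 1 := by
  have h₁ : ∑ t ∈ Finset.range (N + 1), (-1 : ℚ) ^ t * n.choose t = if n = 0 then 1 else 0 := by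
    rw [← Finset.sum_subset (Finset.range_subset_range.2 (Nat.succ_le_succ h))
      fun t _ ht => by
        rw [Nat.choose_eq_zero_of_lt (by simpa using ht), Nat.cast_zero, mul_zero]]
    exact_mod_cast Int.alternating_sum_range_choose (n := n)
  rw [Finset.range_eq_Ico, Finset.sum_eq_sum_Ico_succ_bot N.succ_pos] at h₁
  have h₂ : Finset.Ico (0 + 1) N.succ = Finset.Icc 1 N := rfl
  rw [h₂] at h₁
  simp only [pow_succ, mul_neg_one, neg_mul, Finset.sum_neg_distrib]
  split_ifs at h₁ ⊢ <;> simp at h₁ <;> linarith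


/-- In the configuration model with `m` edges, the probability that two distinct nodes
`i`, `j` (with disjoint stub sets `A`, `B` of sizes `k_i`, `k_j`) are connected by at
least one edge equals
`∑_{t=1}^{min(k_i,k_j)} (-1)^{t+1} C(k_i,t) C(k_j,t) t! / ∏_{p=1}^{t}(2m+1-2p)`. -/
theorem stmt_4 (α : Type*) [Fintype α] [DecidableEq α] (m : ℕ) (hm : 1 ≤ m)
    (hcard : Fintype.card α = 2 * m) (A B : Finset α) (hAB : Disjoint A B)
    (ki kj : ℕ) (hA : A.card = ki) (hB : B.card = kj) :
    (Fintype.card {f : {f : α ≃ α // (∀ x, f (f x) = x) ∧ ∀ x, f x ≠ x} //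
        ∃ x ∈ A, f.1 x ∈ B} : ℚ)
      / (Fintype.card {f : α ≃ α // (∀ x, f (f x) = x) ∧ ∀ x, f x ≠ x} : ℚ)
      = ∑ t ∈ Finset.Icc 1 (min ki kj),
          (-1 : ℚ) ^ (t + 1) * ((ki.choose t : ℚ) * (kj.choose t) * t.factorial)
            / ∏ p ∈ Finset.range t, (2 * (m : ℚ) - 1 - 2 * p) := by
  classical
  subst hA hB
  have hM : (Fintype.card (PerfectMatching α) : ℚ) ≠ 0 := by
    have := PerfectMatching.nonempty_of_card hcard
    exact_mod_cast Fintype.card_ne_zero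
  have hodd (p : ℕ) : (2 * (m : ℚ) - 1 - 2 * p) ≠ 0 := by
    intro h
    have h' : (2 * m - 1 - 2 * p : ℤ) = 0 := by exact_mod_cast h
    omega
  have hmin (f : PerfectMatching α) :
      (A.filter fun x => f.1 x ∈ B).card ≤ min A.card B.card :=
    le_min (Finset.card_filter_le _ _)
      (Finset.card_le_card_of_injOn f.1 (fun x hx => (Finset.mem_filter.1 hx).2)
        f.1.injective.injOn)
  have hnum : (Fintype.card {f : PerfectMatching α // ∃ x ∈ A, f.1 x ∈ B} : ℚ) =
      ∑ t ∈ Finset.Icc 1 (min A.card B.card), (-1 : ℚ) ^ (t + 1) *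
        ∑ T ∈ A.powersetCard t, ((PerfectMatching.matchingInto T B).card : ℚ) := by
    calc (Fintype.card {f : PerfectMatching α // ∃ x ∈ A, f.1 x ∈ B} : ℚ)
        = ∑ f : PerfectMatching α,
            if (A.filter fun x => f.1 x ∈ B).card = 0 then (0 : ℚ) else 1 := by
          rw [Fintype.card_subtype, Finset.card_filter, Nat.cast_sum]
          refine Finset.sum_congr rfl fun f _ => ?_
          by_cases h : ∃ x ∈ A, f.1 x ∈ B <;> simp_all [Finset.filter_eq_empty_iff]
      _ = ∑ f : PerfectMatching α, ∑ t ∈ Finset.Icc 1 (min A.card B.card),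
            (-1 : ℚ) ^ (t + 1) * (A.filter fun x => f.1 x ∈ B).card.choose t :=
          Finset.sum_congr rfl fun f _ => (sum_Icc_neg_one_pow_mul_choose (hmin f)).symm
      _ = _ := by
          rw [Finset.sum_comm]
          refine Finset.sum_congr rfl fun t _ => ?_
          rw [← Finset.mul_sum]
          exact_mod_cast congrArg (fun n : ℕ => (-1 : ℚ) ^ (t + 1) * n)
            (PerfectMatching.sum_choose_card_filter A B t)
  have hterm (t : ℕ) : ∑ T ∈ A.powersetCard t, ((PerfectMatching.matchingInto T B).card : ℚ) =
      A.card.choose t * B.card.choose t * t.factorial /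
        (∏ p ∈ Finset.range t, (2 * (m : ℚ) - 1 - 2 * p)) *
          Fintype.card (PerfectMatching α) := by
    have hprod := Finset.prod_ne_zero_iff.2 fun p (_ : p ∈ Finset.range t) => hodd p
    rw [Finset.sum_congr rfl (g := fun _ => (B.card.descFactorial t : ℚ) *
      Fintype.card (PerfectMatching α) / ∏ p ∈ Finset.range t, (2 * (m : ℚ) - 1 - 2 * p))]
    · rw [Finset.sum_const, Finset.card_powersetCard, nsmul_eq_mul,
        Nat.descFactorial_eq_factorial_mul_choose]
      push_cast
      ring
    · intro T hT
      obtain ⟨hTA, rfl⟩ := Finset.mem_powersetCard.1 hT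
      rw [eq_div_iff hprod]
      simpa [hcard] using PerfectMatching.card_matchingInto_mul_prod (hAB.mono_left hTA)
  rw [div_eq_iff hM, Finset.sum_mul]
  refine hnum.trans (Finset.sum_congr rfl fun t _ => ?_)
  rw [hterm]
  ring
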